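/- Let N ≥ 2 and let s, t be real numbers with -∞ < s ≤ t < N, and set α_{N,t} := (N-t)·ω_{N-1}^{1/(N-1)}. Then the constant α_{N,t} is sharp for the exponentially weighted inequality: the supremum, over all u ∈ L^N(ℝ^N;|x|^{-s}dx) ∩ Ẇ^{1,N}(ℝ^N) with u not almost everywhere zero and ∫_{ℝ^N}|∇u|^N dx ≤ 1, of the ratio ∫_{ℝ^N} e^{α_{N,t}|u|^{N/(N-1)}} |u|^N |x|^{-t} dx / (∫_{ℝ^N} |u|^N |x|^{-s} dx)^{(N-t)/(N-s)} is equal to +∞. -/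

import Mathlib

open MeasureTheory Real

/-- Surface area of the unit sphere `S^{N-1}` in `ℝ^N`, i.e. `ω_{N-1} = N · vol(B(0,1))`. -/
noncomputable def sphereArea (N : ℕ) : ℝ :=
  N * (volume (Metric.ball (0 : EuclideanSpace ℝ (Fin N)) 1)).toReal

/-- `Φ_N(τ) = Σ_{j ≥ N-1} τ^j / j!`, the exponential series with the first `N-1` terms removed. -/
noncomputable def PhiN (N : ℕ) (τ : ℝ) : ℝ :=
  ∑' j : ℕ, τ ^ (j + (N - 1)) / (Nat.factorial (j + (N - 1)) : ℝ)

/-- `g` is the weak gradient of `u` on `ℝ^N`: both are locally integrable and the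
integration-by-parts identity holds against all smooth compactly supported test functions. -/
def HasWeakGradient {N : ℕ} (u : EuclideanSpace ℝ (Fin N) → ℝ)
    (g : EuclideanSpace ℝ (Fin N) → EuclideanSpace ℝ (Fin N)) : Prop :=
  LocallyIntegrable u volume ∧ LocallyIntegrable g volume ∧
  ∀ φ : EuclideanSpace ℝ (Fin N) → ℝ, ContDiff ℝ (⊤ : ℕ∞) φ → HasCompactSupport φ →
    ∀ i : Fin N,
      ∫ x, u x * fderiv ℝ φ x (EuclideanSpace.single i 1) = - ∫ x, g x i * φ x

theorem sphereArea_pos {N : ℕ} (hN : N ≠ 0) : 0 < sphereArea N := by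
  unfold sphereArea
  have h : 0 < (volume (Metric.ball (0 : EuclideanSpace ℝ (Fin N)) 1)).toReal :=
    ENNReal.toReal_pos (Metric.measure_ball_pos _ _ one_pos).ne' measure_ball_lt_top.ne
  have : 0 < (N : ℝ) := by positivity
  positivity

/-- Polar coordinates for powers of the norm on radial regions. -/
theorem setLIntegral_norm_rpow {N : ℕ} (hN : N ≠ 0) (p : ℝ) {S : Set ℝ} (hS : MeasurableSet S)
    (hS0 : S ⊆ Set.Ioi 0) (hint : IntegrableOn (fun y : ℝ => y ^ ((N : ℝ) - 1 + p)) S) :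
    ∫⁻ x in {x : EuclideanSpace ℝ (Fin N) | ‖x‖ ∈ S}, ENNReal.ofReal (‖x‖ ^ p) =
      ENNReal.ofReal (sphereArea N * ∫ y in S, y ^ ((N : ℝ) - 1 + p)) := by
  have : Nonempty (Fin N) := ⟨⟨0, Nat.pos_of_ne_zero hN⟩⟩
  have hT : MeasurableSet {x : EuclideanSpace ℝ (Fin N) | ‖x‖ ∈ S} := measurable_norm hS
  have hfun : ∀ y ∈ S, y ^ (N - 1) • S.indicator (fun y => y ^ p) y = y ^ ((N : ℝ) - 1 + p) := by
    intro y hy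
    have hy0 : 0 < y := hS0 hy
    rw [Set.indicator_of_mem hy, smul_eq_mul, ← Real.rpow_natCast, ← Real.rpow_add hy0,
      Nat.cast_sub (Nat.one_le_iff_ne_zero.2 hN), Nat.cast_one]
  have hind : ∀ y : ℝ, y ^ (N - 1) • S.indicator (fun y => y ^ p) y =
      S.indicator (fun y => y ^ ((N : ℝ) - 1 + p)) y := by
    intro y
    by_cases hy : y ∈ S
    · rw [hfun y hy, Set.indicator_of_mem hy]
    · simp [hy]
  have hI : Integrable (fun x : EuclideanSpace ℝ (Fin N) => S.indicator (fun y => y ^ p) ‖x‖) := by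
    rw [integrable_fun_norm_addHaar volume (f := S.indicator (fun y => y ^ p))]
    simp only [finrank_euclideanSpace, Fintype.card_fin, hind]
    exact (hint.integrable_indicator hS).integrableOn
  have hval := integral_fun_norm_addHaar (volume : Measure (EuclideanSpace ℝ (Fin N)))
    (S.indicator (fun y => y ^ p))
  simp only [finrank_euclideanSpace, Fintype.card_fin, hind] at hval
  rw [← integral_indicator measurableSet_Ioi, Set.indicator_indicator,
    Set.inter_eq_self_of_subset_right hS0, integral_indicator hS] at hval
  have harea : sphereArea N * ∫ y in S, y ^ ((N : ℝ) - 1 + p) =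
      ∫ x : EuclideanSpace ℝ (Fin N), S.indicator (fun y => y ^ p) ‖x‖ := by
    rw [hval, sphereArea, mul_assoc, nsmul_eq_mul, smul_eq_mul, Measure.real]
  rw [harea, ofReal_integral_eq_lintegral_ofReal hI, ← lintegral_indicator hT]
  · refine lintegral_congr fun x => ?_
    by_cases hx : ‖x‖ ∈ S <;> simp [hx]
  · refine Filter.Eventually.of_forall fun x => ?_
    exact Set.indicator_nonneg (fun y hy => Real.rpow_nonneg (hS0 hy).le _) _

theorem setLIntegral_norm_rpow_ball {N : ℕ} (hN : N ≠ 0) {t a : ℝ} (ht : t < N) (ha : 0 < a) :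
    ∫⁻ x in {x : EuclideanSpace ℝ (Fin N) | ‖x‖ ∈ Set.Ioo 0 a}, ENNReal.ofReal (‖x‖ ^ (-t)) =
      ENNReal.ofReal (sphereArea N * (a ^ (N - t) / (N - t))) := by
  rw [setLIntegral_norm_rpow hN _ measurableSet_Ioo fun y hy => hy.1]
  · rw [← integral_Ioc_eq_integral_Ioo, ← intervalIntegral.integral_of_le ha.le,
      integral_rpow (Or.inl (by linarith)),
      show (N : ℝ) - 1 + -t + 1 = N - t by ring, Real.zero_rpow (by linarith), sub_zero]
  · rw [intervalIntegral.integrableOn_Ioo_rpow_iff ha]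
    linarith

theorem setLIntegral_norm_rpow_annulus {N : ℕ} (hN : N ≠ 0) {a : ℝ} (ha : 0 < a) (ha1 : a ≤ 1) :
    ∫⁻ x in {x : EuclideanSpace ℝ (Fin N) | ‖x‖ ∈ Set.Ioo a 1},
        ENNReal.ofReal (‖x‖ ^ (-(N : ℝ))) =
      ENNReal.ofReal (sphereArea N * -Real.log a) := by
  have h0 : (0 : ℝ) ∉ Set.uIcc a 1 := by
    rw [Set.uIcc_of_le ha1]; exact fun h => absurd h.1 (not_le.2 ha)
  rw [setLIntegral_norm_rpow hN _ measurableSet_Ioo fun y hy => ha.trans hy.1]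
  · rw [show (N : ℝ) - 1 + -N = -1 by ring, ← integral_Ioc_eq_integral_Ioo,
      ← intervalIntegral.integral_of_le ha1]
    simp only [Real.rpow_neg_one]
    rw [integral_inv h0, one_div, Real.log_inv]
  · have := intervalIntegral.intervalIntegrable_rpow (μ := volume) (a := a) (b := 1)
      (r := (N : ℝ) - 1 + -N) (Or.inr h0)
    rw [intervalIntegrable_iff_integrableOn_Ioo_of_le ha1] at this
    exact this

/-- A Lipschitz function has its pointwise gradient as weak gradient. -/
theorem LipschitzWith.hasWeakGradient_gradient {N : ℕ} {u : EuclideanSpace ℝ (Fin N) → ℝ}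
    {C : NNReal} (hu : LipschitzWith C u) : HasWeakGradient u (gradient u) := by
  have hnorm : ∀ x, ‖gradient u x‖ ≤ C := fun x => by
    rw [gradient, LinearIsometryEquiv.norm_map]
    exact norm_fderiv_le_of_lipschitz ℝ hu
  have hmeas : Measurable (gradient u) :=
    (InnerProductSpace.toDual ℝ (EuclideanSpace ℝ (Fin N))).symm.continuous.measurable.comp
      (measurable_fderiv ℝ u)
  refine ⟨hu.continuous.locallyIntegrable, ?_, fun φ hφ hc i => ?_⟩
  · exact (memLp_top_of_bound hmeas.aestronglyMeasurable C
      (Filter.Eventually.of_forall hnorm)).locallyIntegrable le_top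
  · obtain ⟨D, hD⟩ := hφ.lipschitzWith_of_hasCompactSupport hc (by simp)
    have key := LipschitzWith.integral_lineDeriv_mul_eq (μ := volume) hu hD hc
      (EuclideanSpace.single i 1)
    have h1 : ∫ x, lineDeriv ℝ u x (EuclideanSpace.single i 1) * φ x =
        ∫ x, gradient u x i * φ x := by
      refine integral_congr_ae ?_
      filter_upwards [hu.ae_differentiableAt (μ := volume)] with x hx
      have h2 : inner ℝ (gradient u x) (EuclideanSpace.single i (1 : ℝ)) =
          fderiv ℝ u x (EuclideanSpace.single i 1) := by
        rw [← toDual_gradient]; rfl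
      rw [hx.lineDeriv_eq_fderiv, ← h2, EuclideanSpace.inner_single_right]
      simp
    rw [← h1, key, ← integral_neg]
    refine integral_congr_ae (Filter.Eventually.of_forall fun x => ?_)
    simp only
    rw [(hφ.differentiable (by simp) x).lineDeriv_eq_fderiv]
    simp [mul_comm]

/-- The truncated logarithm `log (1 / |x|)`, cut off below at `0` and above at `log (1 / a)`. -/
noncomputable def truncLog {N : ℕ} (a : ℝ) (x : EuclideanSpace ℝ (Fin N)) : ℝ :=
  -Real.log (max a (min ‖x‖ 1))

section truncLog

variable {N : ℕ} {a : ℝ} {x : EuclideanSpace ℝ (Fin N)}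

theorem truncLog_of_norm_le (h : ‖x‖ ≤ a) : truncLog a x = -Real.log a := by
  rw [truncLog, max_eq_left ((min_le_left _ _).trans h)]

theorem truncLog_of_one_le_norm (ha : a ≤ 1) (h : 1 ≤ ‖x‖) : truncLog a x = 0 := by
  rw [truncLog, min_eq_right h, max_eq_right ha, Real.log_one, neg_zero]

theorem truncLog_of_norm_mem (h : ‖x‖ ∈ Set.Icc a 1) : truncLog a x = -Real.log ‖x‖ := by
  rw [truncLog, min_eq_left h.2, max_eq_right h.1]

theorem truncLog_nonneg (ha : 0 < a) (ha1 : a ≤ 1) : 0 ≤ truncLog a x :=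
  neg_nonneg.2 <| Real.log_nonpos (ha.le.trans (le_max_left _ _)) (max_le ha1 (min_le_right _ _))

theorem truncLog_le_neg_log_norm (hx : 0 < ‖x‖) (hx1 : ‖x‖ ≤ 1) :
    truncLog a x ≤ -Real.log ‖x‖ := by
  rw [truncLog, min_eq_left hx1]
  exact neg_le_neg (Real.log_le_log hx (le_max_right _ _))

theorem lipschitzWith_truncLog (ha : 0 < a) :
    LipschitzWith a⁻¹.toNNReal (truncLog a : EuclideanSpace ℝ (Fin N) → ℝ) := by
  have hlog : LipschitzOnWith a⁻¹.toNNReal Real.log (Set.Ici a) := by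
    refine LipschitzOnWith.of_le_add_mul _ fun p hp q hq => ?_
    have hp0 : 0 < p := ha.trans_le hp
    have hq0 : 0 < q := ha.trans_le hq
    rw [Real.coe_toNNReal _ (inv_nonneg.2 ha.le), Real.dist_eq]
    have h1 := Real.log_le_sub_one_of_pos (div_pos hp0 hq0)
    rw [Real.log_div hp0.ne' hq0.ne'] at h1
    have h2 : p / q - 1 ≤ a⁻¹ * |p - q| := by
      calc p / q - 1 = q⁻¹ * (p - q) := by field_simp
        _ ≤ q⁻¹ * |p - q| := by gcongr; exact le_abs_self _
        _ ≤ a⁻¹ * |p - q| := by gcongr; exact hq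
    linarith
  have hclamp : LipschitzWith 1 fun x : EuclideanSpace ℝ (Fin N) => max a (min ‖x‖ 1) :=
    (lipschitzWith_one_norm.min_const 1).const_max a
  have := hlog.comp (hclamp.lipschitzOnWith (s := Set.univ)) fun x _ =>
    Set.mem_Ici.2 (le_max_left _ _)
  rw [mul_one, lipschitzOnWith_univ] at this
  exact this.neg

theorem norm_gradient_truncLog_le (h : ‖x‖ ∈ Set.Ioo a 1) (ha : 0 < a) (c : ℝ) (hc : 0 ≤ c) :
    ‖gradient (fun x => c * truncLog a x) x‖ ≤ c * ‖x‖⁻¹ := by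
  have hx0 : 0 < ‖x‖ := ha.trans h.1
  have hev : (fun x => c * truncLog a x) =ᶠ[nhds x] fun x => c * -Real.log ‖x‖ := by
    filter_upwards [continuous_norm.continuousAt.preimage_mem_nhds (Ioo_mem_nhds h.1 h.2)]
      with y hy
    rw [truncLog_of_norm_mem ⟨hy.1.le, hy.2.le⟩]
  have hd : DifferentiableAt ℝ (fun y : EuclideanSpace ℝ (Fin N) => ‖y‖) x :=
    (contDiffAt_norm ℝ (norm_pos_iff.1 hx0)).differentiableAt (n := 1) (by simp)
  have hf := (hd.hasFDerivAt.log hx0.ne').neg.const_mul c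
  rw [gradient, LinearIsometryEquiv.norm_map, hev.fderiv_eq]
  erw [hf.fderiv]
  have h1 : ‖fderiv ℝ (fun y : EuclideanSpace ℝ (Fin N) => ‖y‖) x‖ ≤ 1 := by
    simpa using norm_fderiv_le_of_lipschitz ℝ (x₀ := x)
      (lipschitzWith_one_norm (E := EuclideanSpace ℝ (Fin N)))
  rw [norm_smul, norm_neg, norm_smul, norm_inv, norm_norm, Real.norm_of_nonneg hc]
  gcongr
  exact mul_le_of_le_one_right (inv_nonneg.2 hx0.le) h1

theorem gradient_truncLog_eq_zero (ha : a ≤ 1) (h : ‖x‖ ∉ Set.Icc a 1) (c : ℝ) :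
    gradient (fun x => c * truncLog a x) x = 0 := by
  have hev : ∃ k : ℝ, (fun x => c * truncLog a x) =ᶠ[nhds x] fun _ => k := by
    by_cases h1 : ‖x‖ < a
    · refine ⟨c * -Real.log a, ?_⟩
      filter_upwards [continuous_norm.continuousAt.preimage_mem_nhds (Iio_mem_nhds h1)] with y hy
      rw [truncLog_of_norm_le (le_of_lt hy)]
    · have h2 : 1 < ‖x‖ := by
        by_contra h3
        exact h ⟨not_lt.1 h1, not_lt.1 h3⟩
      refine ⟨0, ?_⟩
      filter_upwards [continuous_norm.continuousAt.preimage_mem_nhds (Ioi_mem_nhds h2)] with y hy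
      rw [truncLog_of_one_le_norm ha (le_of_lt hy), mul_zero]
  obtain ⟨k, hk⟩ := hev
  rw [gradient, hk.fderiv_eq]
  simp

end truncLog

/-- With weight `c = (ω L)^{-1/N}`, the truncated logarithm at level `L` has energy at most one. -/
theorem lintegral_norm_gradient_truncLog_le {N : ℕ} (hN : 2 ≤ N) {L c : ℝ} (hL : 0 < L)
    (hc : 0 < c) (hcN : c ^ (N : ℝ) = (sphereArea N * L)⁻¹) :
    ∫⁻ x : EuclideanSpace ℝ (Fin N), ENNReal.ofReal
      (‖gradient (fun x => c * truncLog (Real.exp (-L)) x) x‖ ^ (N : ℝ)) ≤ 1 := by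
  have hN0 : N ≠ 0 := by omega
  have hNpos : (0 : ℝ) < N := by positivity
  have hω := sphereArea_pos hN0
  have : Nonempty (Fin N) := ⟨⟨0, by omega⟩⟩
  set a := Real.exp (-L) with ha_def
  have ha : 0 < a := Real.exp_pos _
  have ha1 : a ≤ 1 := Real.exp_le_one_iff.2 (by linarith)
  set T := {x : EuclideanSpace ℝ (Fin N) | ‖x‖ ∈ Set.Ioo a 1}
  have hT : MeasurableSet T := measurable_norm measurableSet_Ioo
  have hsphere (r : ℝ) : ∀ᵐ x : EuclideanSpace ℝ (Fin N), ‖x‖ ≠ r := by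
    rw [ae_iff]
    have := Measure.addHaar_sphere (volume : Measure (EuclideanSpace ℝ (Fin N))) 0 r
    simpa [Metric.sphere] using this
  calc _ ≤ ∫⁻ x, T.indicator
        (fun x => ENNReal.ofReal (c ^ (N : ℝ)) * ENNReal.ofReal (‖x‖ ^ (-(N : ℝ)))) x := by
        refine lintegral_mono_ae ?_
        filter_upwards [hsphere a, hsphere 1] with x hxa hx1
        by_cases hx : ‖x‖ ∈ Set.Ioo a 1
        · rw [Set.indicator_of_mem (show x ∈ T from hx),
            ← ENNReal.ofReal_mul (Real.rpow_nonneg hc.le _)]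
          refine ENNReal.ofReal_le_ofReal ?_
          calc _ ≤ (c * ‖x‖⁻¹) ^ (N : ℝ) :=
                Real.rpow_le_rpow (norm_nonneg _) (norm_gradient_truncLog_le hx ha c hc.le) hNpos.le
            _ = _ := by
                rw [Real.mul_rpow hc.le (by positivity), Real.inv_rpow (norm_nonneg _),
                  Real.rpow_neg (norm_nonneg _)]
        · have : ‖x‖ ∉ Set.Icc a 1 := fun h =>
            hx ⟨lt_of_le_of_ne h.1 (Ne.symm hxa), lt_of_le_of_ne h.2 hx1⟩
          rw [gradient_truncLog_eq_zero ha1 this, norm_zero, Real.zero_rpow hNpos.ne']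
          simp
    _ = 1 := by
        rw [lintegral_indicator hT, lintegral_const_mul' _ _ ENNReal.ofReal_ne_top,
          setLIntegral_norm_rpow_annulus hN0 ha ha1, ← ENNReal.ofReal_mul (Real.rpow_nonneg hc.le _),
          hcN, ha_def, Real.log_exp, neg_neg, inv_mul_cancel₀ (by positivity), ENNReal.ofReal_one]

theorem lintegral_truncLog_rpow_le {N : ℕ} (hN : N ≠ 0) {s L c : ℝ} (hs : s < N) (hL : 1 ≤ L)
    (hc : 0 < c) (hcN : c ^ (N : ℝ) = (sphereArea N * L)⁻¹) :
    ∫⁻ x : EuclideanSpace ℝ (Fin N), ENNReal.ofReal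
        (|c * truncLog (Real.exp (-L)) x| ^ (N : ℝ) * ‖x‖ ^ (-s)) ≤
      ENNReal.ofReal ((2 * N / (N - s)) ^ (N : ℝ) * (2 / (N - s))) := by
  have hNpos : (0 : ℝ) < N := by positivity
  have hω := sphereArea_pos hN
  have hNs : 0 < (N : ℝ) - s := by linarith
  have : Nonempty (Fin N) := ⟨⟨0, by omega⟩⟩
  set a := Real.exp (-L)
  have ha : 0 < a := Real.exp_pos _
  have ha1 : a ≤ 1 := Real.exp_le_one_iff.2 (by linarith)
  set ε : ℝ := (N - s) / (2 * N) with hε_def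
  have hε : 0 < ε := by positivity
  set σ : ℝ := s + ε * N with hσ_def
  have hσ : (N : ℝ) - σ = (N - s) / 2 := by
    rw [hσ_def, hε_def]; field_simp; ring
  set T := {x : EuclideanSpace ℝ (Fin N) | ‖x‖ ∈ Set.Ioo 0 (1 : ℝ)}
  have hT : MeasurableSet T := measurable_norm measurableSet_Ioo
  have hK : 0 ≤ (c * (1 / ε)) ^ (N : ℝ) := by positivity
  calc _ ≤ ∫⁻ x, T.indicator
        (fun x => ENNReal.ofReal ((c * (1 / ε)) ^ (N : ℝ)) * ENNReal.ofReal (‖x‖ ^ (-σ))) x := by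
        refine lintegral_mono_ae ?_
        filter_upwards [Measure.ae_ne volume (0 : EuclideanSpace ℝ (Fin N))] with x hx0
        have hx0 : 0 < ‖x‖ := norm_pos_iff.2 hx0
        by_cases hx : ‖x‖ < 1
        · rw [Set.indicator_of_mem (show x ∈ T from ⟨hx0, hx⟩), ← ENNReal.ofReal_mul hK]
          refine ENNReal.ofReal_le_ofReal ?_
          have hlog : -Real.log ‖x‖ ≤ 1 / ε * ‖x‖ ^ (-ε) := by
            have h1 := (Real.abs_log_mul_self_rpow_lt ‖x‖ ε hx0 hx.le hε).le
            rw [abs_mul, abs_of_pos (Real.rpow_pos_of_pos hx0 ε)] at h1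
            rw [Real.rpow_neg hx0.le, ← div_eq_mul_inv, le_div_iff₀ (Real.rpow_pos_of_pos hx0 ε)]
            refine le_trans ?_ h1
            gcongr
            exact neg_le_abs _
          have hu0 : 0 ≤ c * truncLog a x := mul_nonneg hc.le (truncLog_nonneg ha ha1)
          have hu : |c * truncLog a x| ≤ c * (1 / ε) * ‖x‖ ^ (-ε) := by
            rw [abs_of_nonneg hu0, mul_assoc]
            gcongr
            exact (truncLog_le_neg_log_norm hx0 hx.le).trans hlog
          calc _ ≤ (c * (1 / ε) * ‖x‖ ^ (-ε)) ^ (N : ℝ) * ‖x‖ ^ (-s) := by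
                gcongr
            _ = _ := by
                rw [Real.mul_rpow (by positivity) (by positivity), ← Real.rpow_mul hx0.le,
                  mul_assoc, ← Real.rpow_add hx0]
                congr 2
                rw [hσ_def]; ring
        · rw [truncLog_of_one_le_norm ha1 (not_lt.1 hx), mul_zero, abs_zero,
            Real.zero_rpow hNpos.ne']
          simp
    _ = ENNReal.ofReal ((c * (1 / ε)) ^ (N : ℝ) * (sphereArea N * (1 / (N - σ)))) := by
        rw [lintegral_indicator hT, lintegral_const_mul' _ _ ENNReal.ofReal_ne_top,
          setLIntegral_norm_rpow_ball hN (by linarith) one_pos, Real.one_rpow,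
          ← ENNReal.ofReal_mul hK]
    _ ≤ _ := by
        refine ENNReal.ofReal_le_ofReal ?_
        rw [Real.mul_rpow hc.le (by positivity), hcN, hσ, hε_def, one_div_div, one_div_div]
        have h1 : (sphereArea N * L)⁻¹ * sphereArea N ≤ 1 := by
          rw [mul_inv, mul_right_comm, inv_mul_cancel₀ hω.ne', one_mul]
          exact inv_le_one_of_one_le₀ hL
        calc _ = ((sphereArea N * L)⁻¹ * sphereArea N) *
              ((2 * N / (N - s)) ^ (N : ℝ) * (2 / (N - s))) := by ring
          _ ≤ _ := mul_le_of_le_one_left (by positivity) h1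

theorem le_lintegral_exp_truncLog {N : ℕ} (hN : 2 ≤ N) {t L c : ℝ} (ht : t < N) (hL : 1 ≤ L)
    (hc : 0 < c) (hcN : c ^ (N : ℝ) = (sphereArea N * L)⁻¹) :
    ENNReal.ofReal (L * (1 / (N - t))) ≤ ∫⁻ x : EuclideanSpace ℝ (Fin N), ENNReal.ofReal
      (Real.exp ((((N : ℝ) - t) * sphereArea N ^ (1 / ((N : ℝ) - 1))) *
          |c * truncLog (Real.exp (-L)) x| ^ ((N : ℝ) / ((N : ℝ) - 1))) *
        |c * truncLog (Real.exp (-L)) x| ^ (N : ℝ) * ‖x‖ ^ (-t)) := by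
  have hN0 : N ≠ 0 := by omega
  have hN2 : (2 : ℝ) ≤ N := by exact_mod_cast hN
  have hN1 : 0 < (N : ℝ) - 1 := by linarith
  have hω := sphereArea_pos hN0
  have hL0 : 0 < L := by linarith
  have hNt : 0 < (N : ℝ) - t := by linarith
  set a := Real.exp (-L) with ha_def
  have ha : 0 < a := Real.exp_pos _
  set T := {x : EuclideanSpace ℝ (Fin N) | ‖x‖ ∈ Set.Ioo 0 a}
  have hT : MeasurableSet T := measurable_norm measurableSet_Ioo
  have hpow : (c * L) ^ (N : ℝ) = L ^ ((N : ℝ) - 1) / sphereArea N := by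
    rw [Real.mul_rpow hc.le hL0.le, hcN, Real.rpow_sub hL0, Real.rpow_one]
    field_simp
  have hpow' : (c * L) ^ ((N : ℝ) / ((N : ℝ) - 1)) = L / sphereArea N ^ (1 / ((N : ℝ) - 1)) := by
    rw [div_eq_mul_one_div (N : ℝ), Real.rpow_mul (by positivity), hpow,
      Real.div_rpow (by positivity) hω.le, ← Real.rpow_mul hL0.le, mul_one_div_cancel hN1.ne',
      Real.rpow_one]
  have hroot : 0 < sphereArea N ^ (1 / ((N : ℝ) - 1)) := by positivity
  set K : ℝ := Real.exp ((N - t) * L) * (L ^ ((N : ℝ) - 1) / sphereArea N) with hK_def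
  have hK : 0 ≤ K := by positivity
  calc _ ≤ ENNReal.ofReal (K * (sphereArea N * (a ^ ((N : ℝ) - t) / (N - t)))) := by
        refine ENNReal.ofReal_le_ofReal ?_
        have hexp : Real.exp ((N - t) * L) * a ^ ((N : ℝ) - t) = 1 := by
          rw [ha_def, ← Real.exp_mul, ← Real.exp_add, Real.exp_eq_one_iff]; ring
        calc L * (1 / (N - t)) ≤ L ^ ((N : ℝ) - 1) * (1 / (N - t)) := by
              gcongr
              exact Real.self_le_rpow_of_one_le hL (by linarith)
          _ = (Real.exp ((N - t) * L) * a ^ ((N : ℝ) - t)) *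
                (L ^ ((N : ℝ) - 1) * (1 / (N - t))) := by rw [hexp, one_mul]
          _ = _ := by rw [hK_def]; field_simp
    _ = ∫⁻ x in T, ENNReal.ofReal K * ENNReal.ofReal (‖x‖ ^ (-t)) := by
        rw [lintegral_const_mul' _ _ ENNReal.ofReal_ne_top, setLIntegral_norm_rpow_ball hN0 ht ha,
          ← ENNReal.ofReal_mul hK]
    _ = ∫⁻ x in T, ENNReal.ofReal
          (Real.exp ((((N : ℝ) - t) * sphereArea N ^ (1 / ((N : ℝ) - 1))) *
              |c * truncLog a x| ^ ((N : ℝ) / ((N : ℝ) - 1))) *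
            |c * truncLog a x| ^ (N : ℝ) * ‖x‖ ^ (-t)) := by
        refine setLIntegral_congr_fun hT fun x hx => ?_
        have hx' : truncLog a x = L := by
          rw [truncLog_of_norm_le hx.2.le, ha_def, Real.log_exp, neg_neg]
        simp only [hx', abs_of_pos (mul_pos hc hL0), hpow, hpow']
        rw [← ENNReal.ofReal_mul hK, hK_def]
        congr 4
        field_simp
    _ ≤ _ := setLIntegral_le_lintegral _ _

theorem not_truncLog_ae_eq_zero {N : ℕ} {L c : ℝ} (hL : 0 < L) (hc : 0 < c) :
    ¬ ((fun x : EuclideanSpace ℝ (Fin N) => c * truncLog (Real.exp (-L)) x) =ᵐ[volume]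
      fun _ => (0 : ℝ)) := by
  intro h
  have hcont : Continuous fun x : EuclideanSpace ℝ (Fin N) => c * truncLog (Real.exp (-L)) x :=
    continuous_const.mul (lipschitzWith_truncLog (Real.exp_pos _)).continuous
  have h0 := congrFun ((hcont.ae_eq_iff_eq volume continuous_const).1 h) 0
  rw [truncLog_of_norm_le (by rw [norm_zero]; exact (Real.exp_pos _).le), Real.log_exp,
    neg_neg] at h0
  exact (mul_pos hc hL).ne' h0

/-- **Sharpness of `α_{N,t}` in the exponentially weighted inequality (Theorem 1.2).**
At `α = α_{N,t} = (N-t)·ω_{N-1}^{1/(N-1)}` the supremum of the ratio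
`∫ e^{α_{N,t}|u|^{N/(N-1)}}|u|^N|x|^{-t} dx / (∫ |u|^N |x|^{-s} dx)^{(N-t)/(N-s)}`
over admissible `u` (not a.e. zero, `∫|∇u|^N ≤ 1`) is `+∞`. -/
theorem weighted_moser_trudinger_exp_sharp (N : ℕ) (hN : 2 ≤ N) (s t : ℝ) (hst : s ≤ t)
    (htN : t < (N : ℝ)) :
    (⨆ (u : EuclideanSpace ℝ (Fin N) → ℝ)
       (g : EuclideanSpace ℝ (Fin N) → EuclideanSpace ℝ (Fin N))
       (_ : HasWeakGradient u g ∧ ¬ (u =ᵐ[volume] fun _ => (0 : ℝ)) ∧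
            (∫⁻ x, ENNReal.ofReal (|u x| ^ (N : ℝ) * ‖x‖ ^ (-s))) ≠ ⊤ ∧
            (∫⁻ x, ENNReal.ofReal (‖g x‖ ^ (N : ℝ))) ≤ 1),
      (∫⁻ x, ENNReal.ofReal
          (Real.exp ((((N : ℝ) - t) * sphereArea N ^ (1 / ((N : ℝ) - 1))) *
              |u x| ^ ((N : ℝ) / ((N : ℝ) - 1))) * |u x| ^ (N : ℝ) * ‖x‖ ^ (-t))) /
        (∫⁻ x, ENNReal.ofReal (|u x| ^ (N : ℝ) * ‖x‖ ^ (-s))) ^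
          (((N : ℝ) - t) / ((N : ℝ) - s))) = ⊤ := by
  have hN0 : N ≠ 0 := by omega
  have hω := sphereArea_pos hN0
  have hNpos : (0 : ℝ) < N := by positivity
  have hq : 0 ≤ ((N : ℝ) - t) / ((N : ℝ) - s) := div_nonneg (by linarith) (by linarith)
  set M : ENNReal := ENNReal.ofReal ((2 * N / (N - s)) ^ (N : ℝ) * (2 / (N - s)))
  have hM : M ^ (((N : ℝ) - t) / ((N : ℝ) - s)) ≠ ⊤ :=
    ENNReal.rpow_ne_top_of_nonneg hq ENNReal.ofReal_ne_top
  have hlim : Filter.Tendsto (fun L : ℝ => ENNReal.ofReal (L * (1 / (N - t))) /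
      M ^ (((N : ℝ) - t) / ((N : ℝ) - s))) Filter.atTop (nhds ⊤) := by
    have h1 : Filter.Tendsto (fun L : ℝ => ENNReal.ofReal (L * (1 / (N - t))))
        Filter.atTop (nhds ⊤) :=
      ENNReal.tendsto_ofReal_atTop.comp
        (Filter.tendsto_id.atTop_mul_const (one_div_pos.2 (by linarith)))
    have h2 := ENNReal.Tendsto.div_const (b := M ^ (((N : ℝ) - t) / ((N : ℝ) - s))) h1
      (Or.inl ENNReal.top_ne_zero)
    rwa [ENNReal.top_div_of_ne_top hM] at h2
  refine top_le_iff.1 (le_of_tendsto hlim ?_)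
  filter_upwards [Filter.eventually_ge_atTop (1 : ℝ)] with L hL
  have hL0 : 0 < L := by linarith
  set c : ℝ := ((sphereArea N * L)⁻¹) ^ (1 / (N : ℝ)) with hc_def
  have hc : 0 < c := by positivity
  have hcN : c ^ (N : ℝ) = (sphereArea N * L)⁻¹ := by
    rw [hc_def, ← Real.rpow_mul (by positivity), one_div_mul_cancel hNpos.ne', Real.rpow_one]
  have hden := lintegral_truncLog_rpow_le hN0 (hst.trans_lt htN) hL hc hcN
  have hlip := (lipschitzWith_smul c).comp
    (lipschitzWith_truncLog (N := N) (Real.exp_pos (-L)))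
  refine le_iSup_of_le (fun x => c * truncLog (Real.exp (-L)) x) <|
    le_iSup_of_le (gradient fun x => c * truncLog (Real.exp (-L)) x) <|
    le_iSup_of_le ⟨hlip.hasWeakGradient_gradient, not_truncLog_ae_eq_zero hL0 hc,
      ne_top_of_le_ne_top ENNReal.ofReal_ne_top hden,
      lintegral_norm_gradient_truncLog_le hN hL0 hc hcN⟩ ?_
  exact ENNReal.div_le_div (le_lintegral_exp_truncLog hN htN hL hc hcN)
    (ENNReal.rpow_le_rpow hden hq)
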